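/- arXiv:1601.06182 — 2 statements merged into one kernel-verified Lean document; each statement's English description precedes it below -/
import Mathlib

section
/- Let N ≥ 1, let U ⊆ ℝ^N be open, let K ⊆ U be compact, and let φ : U → ℝ be continuously differentiable. Suppose there exist c₀ > 0 and ε₀ > 0 such that ‖∇φ(x)‖ ≥ c₀ for every x ∈ K with |φ(x)| ≤ ε₀. Then there exists a constant C (depending on φ, K, c₀, ε₀) such that for every ε with 0 < ε ≤ ε₀, the Lebesgue measure of the level-set band {x ∈ K : |φ(x)| ≤ ε} is at most C·ε. -/
open MeasureTheory Metric

/-- Packing estimate: a bounded set that never meets its own translates `S - t • v` with `t ≥ τ`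
has measure at most proportional to `τ`. -/
theorem measure_le_of_add_smul_notMem {E : Type*} [NormedAddCommGroup E] [NormedSpace ℝ E]
    [MeasurableSpace E] [BorelSpace E] (μ : Measure E) [μ.IsAddRightInvariant]
    {S : Set E} (hS : MeasurableSet S) {a v : E} {r τ : ℝ} (hSr : S ⊆ closedBall a r)
    (hτ : 0 < τ) (hv : ∀ x ∈ S, ∀ t, τ ≤ t → x + t • v ∉ S) :
    μ S ≤ ENNReal.ofReal τ * μ (closedBall a (r + ‖v‖)) := by
  set n := ⌊1 / τ⌋₊ + 1
  let T : ℕ → Set E := fun k ↦ (fun z ↦ z + -((k * τ) • v)) ⁻¹' S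
  have hTm : ∀ k, MeasurableSet (T k) := fun k ↦ (measurable_add_const _) hS
  have hTμ : ∀ k, μ (T k) = μ S := fun k ↦ measure_preimage_add_right μ _ S
  have hTd : Pairwise (Function.onFun Disjoint T) := by
    rw [pairwise_disjoint_on]
    intro k l hkl
    rw [Set.disjoint_left]
    intro z hzk hzl
    have hkl' : (k : ℝ) + 1 ≤ l := mod_cast hkl
    have hlk : z + -((l * τ) • v) + ((l - k) * τ) • v = z + -((k * τ) • v) := by module
    exact hv _ hzl ((l - k) * τ) (by nlinarith) (hlk ▸ hzk)
  have hTr : ⋃ k ∈ Finset.range n, T k ⊆ closedBall a (r + ‖v‖) := by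
    refine Set.iUnion₂_subset fun k hk z hz ↦ ?_
    have hk' : (k : ℝ) ≤ 1 / τ :=
      (Nat.le_floor_iff (by positivity)).1 (Nat.lt_succ_iff.1 (Finset.mem_range.1 hk))
    have hkτ : (k : ℝ) * τ ≤ 1 := (le_div_iff₀ hτ).1 hk'
    have hzS := hSr hz
    rw [mem_closedBall_iff_norm] at hzS ⊢
    calc ‖z - a‖ = ‖(z + -((k * τ) • v) - a) + (k * τ) • v‖ := by congr 1; abel
      _ ≤ r + ‖((k : ℝ) * τ) • v‖ := (norm_add_le _ _).trans (by gcongr)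
      _ ≤ r + ‖v‖ := by
        rw [norm_smul, Real.norm_of_nonneg (by positivity)]
        gcongr
        exact mul_le_of_le_one_left (norm_nonneg _) hkτ
  have hn : (n : ENNReal) * μ S ≤ μ (closedBall a (r + ‖v‖)) := by
    calc (n : ENNReal) * μ S = ∑ k ∈ Finset.range n, μ (T k) := by simp [hTμ]
      _ = μ (⋃ k ∈ Finset.range n, T k) :=
        (measure_biUnion_finset (hTd.set_pairwise _) fun k _ ↦ hTm k).symm
      _ ≤ _ := measure_mono hTr
  have hτn : 1 ≤ ENNReal.ofReal τ * n := by
    rw [← ENNReal.ofReal_natCast, ← ENNReal.ofReal_mul hτ.le, ENNReal.one_le_ofReal]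
    have : 1 / τ < n := by simpa [n] using Nat.lt_floor_add_one (1 / τ)
    rw [div_lt_iff₀ hτ] at this
    linarith
  calc μ S ≤ ENNReal.ofReal τ * n * μ S := le_mul_of_one_le_left' hτn
    _ ≤ _ := by rw [mul_assoc]; gcongr

/-- Near a regular point, the measure of the bands `{|φ| ≤ ε}` is `O(ε)`. -/
theorem exists_nhds_measure_band_le {E : Type*} [NormedAddCommGroup E] [NormedSpace ℝ E]
    [ProperSpace E] [MeasurableSpace E] [BorelSpace E] (μ : Measure E) [μ.IsAddRightInvariant]
    [IsFiniteMeasureOnCompacts μ] {φ : E → ℝ} {φ' : E →L[ℝ] ℝ} {a : E}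
    (h : HasStrictFDerivAt φ φ' a) (hφ' : φ' ≠ 0) :
    ∃ V ∈ nhds a, ∃ C : ℝ, 0 ≤ C ∧ ∀ ε : ℝ, 0 < ε → ∀ S ⊆ V, MeasurableSet S →
      (∀ x ∈ S, |φ x| ≤ ε) → μ S ≤ ENNReal.ofReal (C * ε) := by
  obtain ⟨w, hw⟩ : ∃ w, φ' w ≠ 0 := by
    by_contra! hw
    exact hφ' (ContinuousLinearMap.ext hw)
  obtain ⟨v, hv⟩ : ∃ v, φ' v = 1 := ⟨(φ' w)⁻¹ • w, by simp [hw]⟩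
  have hδ : 0 < 1 / (2 * (‖v‖ + 1)) := by positivity
  obtain ⟨r, hr, hball⟩ := Metric.eventually_nhds_iff_ball.1 (h.isLittleO.def hδ)
  have hdiff : ∀ x ∈ ball a r, ∀ t : ℝ, 0 ≤ t → x + t • v ∈ ball a r →
      t / 2 ≤ φ (x + t • v) - φ x := by
    intro x hx t ht hxt
    have key := hball (x + t • v, x) (by
      rw [← ball_prod_same]; exact ⟨hxt, hx⟩)
    simp only [add_sub_cancel_left, map_smul, hv, smul_eq_mul, mul_one, norm_smul,
      Real.norm_of_nonneg ht] at key
    have hle : 1 / (2 * (‖v‖ + 1)) * (t * ‖v‖) ≤ t / 2 := by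
      rw [div_mul_eq_mul_div, div_le_div_iff₀ (by positivity) two_pos]
      nlinarith [norm_nonneg v]
    have := (abs_le.1 (key.trans hle)).1
    linarith
  refine ⟨ball a r, ball_mem_nhds a hr, 5 * μ.real (closedBall a (r + ‖v‖)), by positivity, ?_⟩
  intro ε hε S hSV hS hSφ
  have hpack := measure_le_of_add_smul_notMem μ hS (v := v) (hSV.trans ball_subset_closedBall)
    (by positivity : 0 < 5 * ε) (fun x hx t ht hxt ↦ by
      have h1 := hdiff x (hSV hx) t (by linarith) (hSV hxt)
      have h2 := abs_le.1 (hSφ x hx)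
      have h3 := abs_le.1 (hSφ _ hxt)
      linarith)
  refine hpack.trans_eq ?_
  rw [mul_right_comm, ENNReal.ofReal_mul (p := 5 * ε) (by positivity), measureReal_def,
    ENNReal.ofReal_toReal (isCompact_closedBall _ _).measure_lt_top.ne]

/-- Coarea-type estimate: if `φ` is `C¹` on an open set `U` containing the compact set `K`
and its gradient is bounded below by `c₀ > 0` on the part of `K` where `|φ| ≤ ε₀`, then the
measure of the band `{x ∈ K : |φ x| ≤ ε}` is `O(ε)` for `0 < ε ≤ ε₀`. -/
theorem measure_band_le_of_gradient_lower_bound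
    (N : ℕ) (hN : 1 ≤ N) (U : Set (EuclideanSpace ℝ (Fin N))) (hU : IsOpen U)
    (K : Set (EuclideanSpace ℝ (Fin N))) (hK : IsCompact K) (hKU : K ⊆ U)
    (φ : EuclideanSpace ℝ (Fin N) → ℝ) (hφ : ContDiffOn ℝ 1 φ U)
    (c₀ ε₀ : ℝ) (hc₀ : 0 < c₀) (hε₀ : 0 < ε₀)
    (hgrad : ∀ x ∈ K, |φ x| ≤ ε₀ → c₀ ≤ ‖gradient φ x‖) :
    ∃ C : ℝ, ∀ ε : ℝ, 0 < ε → ε ≤ ε₀ →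
      volume {x ∈ K | |φ x| ≤ ε} ≤ ENNReal.ofReal (C * ε) := by
  have hcont : ContinuousOn φ K := hφ.continuousOn.mono hKU
  have hband : ∀ ε, MeasurableSet {x ∈ K | |φ x| ≤ ε} := fun ε ↦
    (hcont.abs.preimage_isClosed_of_isClosed hK.isClosed isClosed_Iic).measurableSet
  suffices ∃ C : ℝ, 0 ≤ C ∧ ∀ ε : ℝ, 0 < ε → ε ≤ ε₀ →
      volume (K ∩ {x ∈ K | |φ x| ≤ ε}) ≤ ENNReal.ofReal (C * ε) by
    obtain ⟨C, -, hC⟩ := this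
    refine ⟨C, fun ε hε hε' ↦ ?_⟩
    rw [← Set.inter_eq_self_of_subset_right (Set.sep_subset K fun x ↦ |φ x| ≤ ε)]
    exact hC ε hε hε'
  refine hK.induction_on (p := fun s ↦ ∃ C : ℝ, 0 ≤ C ∧ ∀ ε : ℝ, 0 < ε → ε ≤ ε₀ →
      volume (s ∩ {x ∈ K | |φ x| ≤ ε}) ≤ ENNReal.ofReal (C * ε)) ⟨0, le_rfl, by simp⟩ ?_ ?_ ?_
  · rintro s t hst ⟨C, hC0, hC⟩
    exact ⟨C, hC0, fun ε hε hε' ↦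
      (measure_mono (Set.inter_subset_inter_left _ hst)).trans (hC ε hε hε')⟩
  · rintro s t ⟨C, hC0, hC⟩ ⟨D, hD0, hD⟩
    refine ⟨C + D, by positivity, fun ε hε hε' ↦ ?_⟩
    rw [Set.union_inter_distrib_right, add_mul,
      ENNReal.ofReal_add (by positivity) (by positivity)]
    exact (measure_union_le _ _).trans (add_le_add (hC ε hε hε') (hD ε hε hε'))
  · intro a ha
    have haU : U ∈ nhds a := hU.mem_nhds (hKU ha)
    have hφa : ContDiffAt ℝ 1 φ a := hφ.contDiffAt haU
    rcases le_or_gt |φ a| ε₀ with hle | hgt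
    · have hne : fderiv ℝ φ a ≠ 0 := by
        intro h0
        have := hgrad a ha hle
        simp only [gradient, h0, map_zero, norm_zero] at this
        linarith
      obtain ⟨V, hV, C, hC0, hC⟩ := exists_nhds_measure_band_le volume
        (hφa.hasStrictFDerivAt one_ne_zero) hne
      obtain ⟨W, hWV, hWo, haW⟩ := _root_.mem_nhds_iff.1 hV
      refine ⟨W, mem_nhdsWithin_of_mem_nhds (hWo.mem_nhds haW), C, hC0, fun ε hε _ ↦ ?_⟩
      exact hC ε hε _ (Set.inter_subset_left.trans hWV)
        (hWo.measurableSet.inter (hband ε)) fun x hx ↦ hx.2.2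
    · refine ⟨{x | ε₀ < |φ x|}, mem_nhdsWithin_of_mem_nhds
        (hφa.continuousAt.abs.eventually (lt_mem_nhds hgt)), 0, le_rfl, fun ε _ hε' ↦ ?_⟩
      have hempty : {x | ε₀ < |φ x|} ∩ {x ∈ K | |φ x| ≤ ε} = ∅ := by
        ext x
        simp only [Set.mem_inter_iff, Set.mem_ofPred_eq, Set.mem_empty_iff_false, iff_false]
        rintro ⟨h1, -, h2⟩
        linarith
      simp [hempty]
end

section
/- Let N ≥ 1, q ≥ 1, β ≥ 1, c > 0 and M > 0. Then there exists a constant C = C(N, q, β, c, M) with the following property: for every h with 0 < h ≤ 1, every x₀ ∈ ℝ^N, every ρ with h/β ≤ ρ ≤ h, every polynomial function p : ℝ^N → ℝ of total degree ≤ q, and every (q+1) times continuously differentiable function φ : ℝ^N → ℝ whose iterated derivatives of all orders j ≤ q+1 are bounded by M on the closed ball B = closedBall(x₀, ρ), if sup_{x ∈ B} |φ(x) − p(x)| ≤ c·h^{q+1}, then sup_{x ∈ B} ‖iterated derivative of order j of p at x‖ ≤ C for every j ≤ q+1. -/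
open Metric

/-- On a finite-dimensional space, a linear map is dominated in norm by any injective one. -/
theorem LinearMap.exists_norm_le_mul_norm_of_injective {V F F' : Type*}
    [AddCommGroup V] [Module ℝ V] [Module.Finite ℝ V]
    [NormedAddCommGroup F] [NormedSpace ℝ F] [NormedAddCommGroup F'] [NormedSpace ℝ F']
    (L : V →ₗ[ℝ] F) (hL : Function.Injective L) (G : V →ₗ[ℝ] F') :
    ∃ C : ℝ, 0 ≤ C ∧ ∀ v, ‖G v‖ ≤ C * ‖L v‖ := by
  let e := LinearEquiv.ofInjective L hL
  let T : LinearMap.range L →L[ℝ] F' := (G ∘ₗ e.symm.toLinearMap).toContinuousLinearMap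
  refine ⟨‖T‖, norm_nonneg T, fun v => ?_⟩
  have h := T.le_opNorm (e v)
  simpa [T, e] using h

/-- The coefficients of a polynomial of bounded degree are controlled by its supremum on `[0, 1]`. -/
theorem Polynomial.exists_abs_coeff_le_of_abs_eval_le (q : ℕ) :
    ∃ C : ℝ, 0 ≤ C ∧ ∀ e : Polynomial ℝ, e.natDegree ≤ q → ∀ A : ℝ,
      (∀ s ∈ Set.Icc (0 : ℝ) 1, |e.eval s| ≤ A) → ∀ k, |e.coeff k| ≤ C * A := by
  let L : Polynomial.degreeLT ℝ (q + 1) →ₗ[ℝ] C(Set.Icc (0 : ℝ) 1, ℝ) :=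
    (Polynomial.toContinuousMapOnAlgHom (Set.Icc (0 : ℝ) 1)).toLinearMap ∘ₗ Submodule.subtype _
  have hL : Function.Injective L := by
    intro a b hab
    refine Subtype.ext (Polynomial.eq_of_infinite_eval_eq _ _
      ((Set.Icc_infinite (zero_lt_one (α := ℝ))).mono fun s hs => ?_))
    simpa [L] using congrArg (fun f : C(Set.Icc (0 : ℝ) 1, ℝ) => f ⟨s, hs⟩) hab
  have : Module.Finite ℝ (Polynomial.degreeLT ℝ (q + 1)) :=
    Module.Finite.equiv (Polynomial.degreeLTEquiv ℝ (q + 1)).symm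
  obtain ⟨C, hC, h⟩ := L.exists_norm_le_mul_norm_of_injective hL
    (Polynomial.degreeLTEquiv ℝ (q + 1)).toLinearMap
  refine ⟨C, hC, fun e he A hA k => ?_⟩
  have hA0 : 0 ≤ A := (abs_nonneg _).trans (hA 0 (by simp))
  rcases lt_or_ge q k with hk | hk
  · rw [Polynomial.coeff_eq_zero_of_natDegree_lt (he.trans_lt hk), abs_zero]
    positivity
  have hmem : e ∈ Polynomial.degreeLT ℝ (q + 1) := by
    rw [Polynomial.mem_degreeLT]
    exact (Polynomial.degree_le_of_natDegree_le he).trans_lt (by exact_mod_cast Nat.lt_succ_self q)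
  have h1 : ‖L ⟨e, hmem⟩‖ ≤ A := by
    rw [ContinuousMap.norm_le _ hA0]
    rintro ⟨s, hs⟩
    simpa [L] using hA s hs
  calc |e.coeff k|
      = ‖Polynomial.degreeLTEquiv ℝ (q + 1) ⟨e, hmem⟩ ⟨k, Nat.lt_succ_of_le hk⟩‖ := rfl
    _ ≤ ‖Polynomial.degreeLTEquiv ℝ (q + 1) ⟨e, hmem⟩‖ := norm_le_pi_norm _ _
    _ ≤ C * ‖L ⟨e, hmem⟩‖ := h ⟨e, hmem⟩
    _ ≤ C * A := by gcongr

theorem MvPolynomial.eq_zero_of_eval_eq_zero_on_closedBall {N : ℕ} {r : ℝ} (hr : 0 < r)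
    {p : MvPolynomial (Fin N) ℝ}
    (h : ∀ x ∈ closedBall (0 : EuclideanSpace ℝ (Fin N)) r, MvPolynomial.eval x p = 0) : p = 0 := by
  have hn : (WithLp.toLp 2 : (Fin N → ℝ) → EuclideanSpace ℝ (Fin N)) ⁻¹' closedBall 0 r
      ∈ nhds (0 : Fin N → ℝ) :=
    (PiLp.continuous_toLp 2 _).continuousAt.preimage_mem_nhds
      (by simpa using closedBall_mem_nhds _ hr)
  obtain ⟨ε, hε, hsub⟩ := Metric.mem_nhds_iff.mp hn
  rw [ball_pi _ hε] at hsub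
  refine MvPolynomial.funext_set (fun i => ball ((0 : Fin N → ℝ) i) ε) (fun i => ?_) fun x hx => ?_
  · rw [Real.ball_eq_Ioo]
    exact Set.Ioo_infinite (by linarith)
  · simpa using h _ (hsub hx)

theorem MvPolynomial.contDiff_eval {N : ℕ} (p : MvPolynomial (Fin N) ℝ) {n : WithTop ℕ∞} :
    ContDiff ℝ n (fun y : EuclideanSpace ℝ (Fin N) => MvPolynomial.eval y p) :=
  (AnalyticOnNhd.eval_continuousLinearMap
    (EuclideanSpace.equiv (Fin N) ℝ).toContinuousLinearMap p).contDiff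

/-- Inverse (Markov-type) estimate: on the unit ball, the derivatives of a polynomial of bounded
total degree are controlled by its supremum. -/
theorem MvPolynomial.exists_norm_iteratedFDeriv_eval_le (N q j : ℕ) :
    ∃ C : ℝ, 0 ≤ C ∧ ∀ p : MvPolynomial (Fin N) ℝ, p.totalDegree ≤ q → ∀ A : ℝ,
      (∀ x ∈ closedBall (0 : EuclideanSpace ℝ (Fin N)) 1, |MvPolynomial.eval x p| ≤ A) →
      ∀ x ∈ closedBall (0 : EuclideanSpace ℝ (Fin N)) 1,
        ‖iteratedFDeriv ℝ j
          (fun y : EuclideanSpace ℝ (Fin N) => MvPolynomial.eval y p) x‖ ≤ C * A := by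
  let K := closedBall (0 : EuclideanSpace ℝ (Fin N)) 1
  have : CompactSpace K := isCompact_iff_compactSpace.mp (isCompact_closedBall _ _)
  let D : MvPolynomial.restrictTotalDegree (Fin N) ℝ q →ₗ[ℝ]
      C(K, ContinuousMultilinearMap ℝ (fun _ : Fin j => EuclideanSpace ℝ (Fin N)) ℝ) :=
    { toFun := fun p =>
        ⟨fun x => iteratedFDeriv ℝ j
          (fun y : EuclideanSpace ℝ (Fin N) => MvPolynomial.eval y p.1) x,
          (p.1.contDiff_eval.continuous_iteratedFDeriv le_rfl).comp continuous_subtype_val⟩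
      map_add' := fun p p' => by
        ext1 x
        simpa using fun_iteratedFDeriv_add_apply (x := x.1) p.1.contDiff_eval.contDiffAt
          p'.1.contDiff_eval.contDiffAt
      map_smul' := fun a p => by
        ext1 x
        simpa [MvPolynomial.smul_eval] using iteratedFDeriv_const_smul_apply' (x := x.1) (a := a)
          p.1.contDiff_eval.contDiffAt }
  let L : MvPolynomial.restrictTotalDegree (Fin N) ℝ q →ₗ[ℝ] C(K, ℝ) :=
    { toFun := fun p => ⟨fun x => MvPolynomial.eval x.1 p.1,
        (p.1.contDiff_eval (n := 0)).continuous.comp continuous_subtype_val⟩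
      map_add' := fun p p' => by ext1 x; simp
      map_smul' := fun a p => by ext1 x; simp [MvPolynomial.smul_eval] }
  have hL : Function.Injective L := by
    rw [injective_iff_map_eq_zero]
    intro p hp
    refine Subtype.ext (MvPolynomial.eq_zero_of_eval_eq_zero_on_closedBall one_pos fun x hx => ?_)
    exact congrArg (fun f : C(K, ℝ) => f ⟨x, hx⟩) hp
  obtain ⟨C, hC, h⟩ := L.exists_norm_le_mul_norm_of_injective hL
    (F' := C(K, ContinuousMultilinearMap ℝ (fun _ : Fin j => EuclideanSpace ℝ (Fin N)) ℝ)) D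
  refine ⟨C, hC, fun p hp A hA x hx => ?_⟩
  have hA0 : 0 ≤ A := (abs_nonneg _).trans (hA x hx)
  let p' : MvPolynomial.restrictTotalDegree (Fin N) ℝ q :=
    ⟨p, (MvPolynomial.mem_restrictTotalDegree _ _ _).mpr hp⟩
  calc _ = ‖D p' ⟨x, hx⟩‖ := rfl
    _ ≤ ‖D p'‖ := ContinuousMap.norm_coe_le_norm _ _
    _ ≤ C * ‖L p'‖ := h p'
    _ ≤ C * A := by
      gcongr
      rw [ContinuousMap.norm_le _ hA0]
      exact fun y => hA y.1 y.2

theorem MvPolynomial.totalDegree_aeval_le {σ τ R : Type*} [CommSemiring R] {m n : ℕ}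
    (F : MvPolynomial σ R) (hF : F.totalDegree ≤ m)
    (f : σ → MvPolynomial τ R) (hf : ∀ i, (f i).totalDegree ≤ n) :
    (MvPolynomial.aeval f F).totalDegree ≤ m * n := by
  rw [MvPolynomial.aeval_def, MvPolynomial.eval₂]
  refine totalDegree_finsetSum_le fun d hd => ?_
  refine (totalDegree_mul _ _).trans ?_
  rw [MvPolynomial.algebraMap_eq, totalDegree_C, zero_add]
  refine (totalDegree_finsetProd _ _).trans ?_
  calc _ ≤ ∑ i ∈ d.support, d i * n :=
        Finset.sum_le_sum fun i _ => (totalDegree_pow _ _).trans (Nat.mul_le_mul_left _ (hf i))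
    _ = d.degree * n := by rw [← Finset.sum_mul]; rfl
    _ ≤ m * n := Nat.mul_le_mul_right _ ((le_totalDegree hd).trans hF)

/-- Directional derivatives along a vector of norm at most one are bounded by the Fréchet ones. -/
theorem norm_iteratedDeriv_comp_line_le {E : Type*} [NormedAddCommGroup E] [NormedSpace ℝ E]
    {φ : E → ℝ} {n : WithTop ℕ∞} (hφ : ContDiff ℝ n φ) (x v : E) (hv : ‖v‖ ≤ 1) {j : ℕ}
    (hj : (j : WithTop ℕ∞) ≤ n) (t : ℝ) :
    ‖iteratedDeriv j (fun t : ℝ => φ (x + t • v)) t‖ ≤ ‖iteratedFDeriv ℝ j φ (x + t • v)‖ := by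
  have h := (ContinuousLinearMap.toSpanSingleton ℝ v).iteratedFDeriv_comp_right
    (f := fun z => φ (x + z)) (hφ.comp (contDiff_const.add contDiff_id)) t hj
  rw [iteratedFDeriv_comp_add_left] at h
  rw [← norm_iteratedFDeriv_eq_norm_iteratedDeriv]
  change ‖iteratedFDeriv ℝ j ((fun z => φ (x + z)) ∘ ContinuousLinearMap.toSpanSingleton ℝ v) t‖ ≤ _
  rw [h]
  refine (ContinuousMultilinearMap.norm_compContinuousLinearMap_le _ _).trans ?_
  simp only [ContinuousLinearMap.norm_toSpanSingleton, Finset.prod_const,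
    ContinuousLinearMap.toSpanSingleton_apply]
  exact mul_le_of_le_one_right (norm_nonneg _) (pow_le_one₀ (norm_nonneg _) hv)

/-- A polynomial of degree at most `q` that approximates, to order `ρ ^ (q + 1)` on `[0, ρ]`, a
function with bounded derivatives is bounded at `1` independently of `ρ`. -/
theorem Polynomial.exists_abs_eval_one_le (q : ℕ) (K M : ℝ) (hM : 0 ≤ M) :
    ∃ C : ℝ, ∀ ρ : ℝ, 0 < ρ → ρ ≤ 1 → ∀ g : Polynomial ℝ, g.natDegree ≤ q →
      ∀ u : ℝ → ℝ, ContDiff ℝ (q + 1) u →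
      (∀ j ≤ q + 1, ∀ t ∈ Set.Icc 0 ρ, |iteratedDeriv j u t| ≤ M) →
      (∀ t ∈ Set.Icc 0 ρ, |u t - g.eval t| ≤ K * ρ ^ (q + 1)) → |g.eval 1| ≤ C := by
  obtain ⟨C₀, hC₀, hcoeff⟩ := Polynomial.exists_abs_coeff_le_of_abs_eval_le q
  refine ⟨∑ _k ∈ Finset.range (q + 1), (C₀ * (K + M) + M),
    fun ρ hρ hρ1 g hg u hu hder happ => ?_⟩
  have hK : 0 ≤ K := by
    have := (abs_nonneg _).trans (happ 0 ⟨le_rfl, hρ.le⟩)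
    exact nonneg_of_mul_nonneg_left this (by positivity)
  have hwithin : ∀ j ≤ q + 1, ∀ t ∈ Set.Icc 0 ρ,
      iteratedDerivWithin j u (Set.Icc 0 ρ) t = iteratedDeriv j u t := fun j hj t ht =>
    iteratedDerivWithin_eq_iteratedDeriv (uniqueDiffOn_Icc hρ)
      (hu.contDiffAt.of_le (by exact_mod_cast hj)) ht
  let a : ℕ → ℝ := fun k => (k.factorial : ℝ)⁻¹ * iteratedDeriv k u 0
  have ha : ∀ k ≤ q, |a k| ≤ M := fun k hk => by
    rw [abs_mul, abs_of_nonneg (by positivity)]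
    calc _ ≤ 1 * M := by
          gcongr
          · exact inv_le_one_of_one_le₀
              (by exact_mod_cast Nat.one_le_iff_ne_zero.mpr k.factorial_ne_zero)
          · exact hder k (by omega) 0 ⟨le_rfl, hρ.le⟩
      _ = M := one_mul M
  let T : Polynomial ℝ := ∑ k ∈ Finset.range (q + 1), Polynomial.C (a k) * Polynomial.X ^ k
  have hTdeg : T.natDegree ≤ q := Polynomial.natDegree_sum_le_of_forall_le _ _ fun k hk =>
    (Polynomial.natDegree_C_mul_X_pow_le _ _).trans (by simpa [Nat.lt_succ_iff] using hk)
  have hTcoeff : ∀ k ≤ q, T.coeff k = a k := fun k hk => by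
    simp [T, Polynomial.finsetSum_coeff, Polynomial.coeff_C_mul, Polynomial.coeff_X_pow]
    omega
  have hTaylor : ∀ t ∈ Set.Icc 0 ρ, |u t - T.eval t| ≤ M * ρ ^ (q + 1) := fun t ht => by
    have h := taylor_mean_remainder_bound hρ.le hu.contDiffOn ht (C := M) fun y hy => by
      rw [hwithin _ le_rfl y hy]; exact hder _ le_rfl y hy
    have hT : taylorWithinEval u q (Set.Icc 0 ρ) 0 t = T.eval t := by
      rw [taylor_within_apply, Polynomial.eval_finsetSum]
      refine Finset.sum_congr rfl fun k hk => ?_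
      rw [hwithin k (by simp at hk; omega) 0 ⟨le_rfl, hρ.le⟩]
      simp [a]
      ring
    rw [hT, Real.norm_eq_abs, sub_zero] at h
    refine h.trans ((div_le_self (mul_nonneg hM (pow_nonneg ht.1 _)) ?_).trans ?_)
    · exact_mod_cast Nat.one_le_iff_ne_zero.mpr q.factorial_ne_zero
    · have := ht.1
      gcongr
      exact ht.2
  let e : Polynomial ℝ := (g - T).comp (Polynomial.C ρ * Polynomial.X)
  have hedeg : e.natDegree ≤ q := by
    refine Polynomial.natDegree_comp_le.trans ?_
    rw [Polynomial.natDegree_C_mul_X _ hρ.ne', mul_one]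
    exact (Polynomial.natDegree_sub_le _ _).trans (max_le hg hTdeg)
  have he := hcoeff e hedeg ((K + M) * ρ ^ (q + 1)) fun s hs => by
    have hmem : ρ * s ∈ Set.Icc 0 ρ :=
      ⟨mul_nonneg hρ.le hs.1, mul_le_of_le_one_right hρ.le hs.2⟩
    have h1 := abs_le.mp (happ _ hmem)
    have h2 := abs_le.mp (hTaylor _ hmem)
    simp only [e, Polynomial.eval_comp, Polynomial.eval_sub, Polynomial.eval_mul,
      Polynomial.eval_C, Polynomial.eval_X]
    rw [abs_le]
    constructor <;> linarith [h1.1, h1.2, h2.1, h2.2]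
  rw [Polynomial.eval_eq_sum_range' (Nat.lt_succ_of_le hg)]
  refine (Finset.abs_sum_le_sum_abs _ _).trans (Finset.sum_le_sum fun k hk => ?_)
  have hk' : k ≤ q := by simpa [Nat.lt_succ_iff] using hk
  have h1 := he k
  rw [Polynomial.comp_C_mul_X_coeff, abs_mul, abs_of_pos (pow_pos hρ k), Polynomial.coeff_sub,
    hTcoeff k hk'] at h1
  have h2 : |g.coeff k - a k| * ρ ^ k ≤ C₀ * (K + M) * ρ ^ k := by
    refine h1.trans ?_
    rw [← mul_assoc]
    exact mul_le_mul_of_nonneg_left (pow_le_pow_of_le_one hρ.le hρ1 (by omega)) (by positivity)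
  have h3 := le_of_mul_le_mul_right h2 (pow_pos hρ k)
  rw [one_pow, mul_one]
  calc |g.coeff k| = |(g.coeff k - a k) + a k| := by rw [sub_add_cancel]
    _ ≤ _ := (abs_add_le _ _).trans (add_le_add h3 (ha k hk'))

/-- Uniform `W^{q+1,∞}` bound on a polynomial approximation of a smooth level-set
function on a shape-regular cell: if `p` (total degree `≤ q`) approximates `φ` to order
`h^{q+1}` on a ball of radius `ρ ∈ [h/β, h]`, and the derivatives of `φ` up to order
`q+1` are bounded by `M` there, then all iterated derivatives of `p` up to order `q+1`
are bounded by a constant `C = C(N, q, β, c, M)` on the ball. -/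
theorem polynomial_approximant_derivatives_bounded
    (N q : ℕ) (hN : 1 ≤ N) (hq : 1 ≤ q) (β c M : ℝ)
    (hβ : 1 ≤ β) (hc : 0 < c) (hM : 0 < M) :
    ∃ C : ℝ, ∀ h : ℝ, 0 < h → h ≤ 1 →
      ∀ (x₀ : EuclideanSpace ℝ (Fin N)) (ρ : ℝ), h / β ≤ ρ → ρ ≤ h →
      ∀ p : MvPolynomial (Fin N) ℝ, p.totalDegree ≤ q →
      ∀ φ : EuclideanSpace ℝ (Fin N) → ℝ, ContDiff ℝ (q + 1) φ →
      (∀ j : ℕ, j ≤ q + 1 → ∀ x ∈ closedBall x₀ ρ, ‖iteratedFDeriv ℝ j φ x‖ ≤ M) →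
      (∀ x ∈ closedBall x₀ ρ, |φ x - MvPolynomial.eval x p| ≤ c * h ^ (q + 1)) →
      ∀ j : ℕ, j ≤ q + 1 → ∀ x ∈ closedBall x₀ ρ,
        ‖iteratedFDeriv ℝ j
          (fun y : EuclideanSpace ℝ (Fin N) => MvPolynomial.eval y p) x‖ ≤ C := by
  obtain ⟨C₁, hC₁⟩ := Polynomial.exists_abs_eval_one_le q (c * β ^ (q + 1)) M hM.le
  choose C₂ hC₂ hderiv using MvPolynomial.exists_norm_iteratedFDeriv_eval_le N q
  refine ⟨∑ j ∈ Finset.range (q + 2), C₂ j * |C₁|,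
    fun h hh hh1 x₀ ρ hρl hρu p hp φ hφ hder happ j hj x hx => ?_⟩
  have hβ0 : 0 < β := one_pos.trans_le hβ
  have hρ : 0 < ρ := (div_pos hh hβ0).trans_le hρl
  have hρ1 : ρ ≤ 1 := hρu.trans hh1
  let P : MvPolynomial (Fin N) ℝ :=
    MvPolynomial.aeval (fun i => MvPolynomial.C (x₀ i) + MvPolynomial.X i) p
  have hPdeg : P.totalDegree ≤ q := by
    refine (MvPolynomial.totalDegree_aeval_le p hp _ (n := 1) fun i => ?_).trans (mul_one q).le
    exact (MvPolynomial.totalDegree_add _ _).trans (by simp)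
  have hP : ∀ z : EuclideanSpace ℝ (Fin N),
      MvPolynomial.eval z P = MvPolynomial.eval (x₀ + z) p := fun z => by
    have h := MvPolynomial.comp_aeval_apply
      (fun i => MvPolynomial.C (x₀ i) + MvPolynomial.X i) (MvPolynomial.aeval (R := ℝ) z) p
    have hf : (fun i => MvPolynomial.aeval (R := ℝ) z (MvPolynomial.C (x₀ i) + MvPolynomial.X i)) =
        (x₀ + z : EuclideanSpace ℝ (Fin N)) := by
      ext i
      simp
    rw [hf] at h
    exact h
  have hbound : ∀ v ∈ closedBall (0 : EuclideanSpace ℝ (Fin N)) 1,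
      |MvPolynomial.eval v P| ≤ |C₁| := fun v hv => by
    rw [mem_closedBall_zero_iff] at hv
    let g : Polynomial ℝ :=
      MvPolynomial.aeval (fun i => Polynomial.C (x₀ i) + Polynomial.C (v i) * Polynomial.X) p
    have hgdeg : g.natDegree ≤ q := by
      simpa using MvPolynomial.aeval_natDegree_le p hp _ (n := 1) fun i => by compute_degree
    have hg : ∀ t : ℝ, g.eval t = MvPolynomial.eval (x₀ + t • v) p := fun t => by
      have h := MvPolynomial.comp_aeval_apply
        (fun i => Polynomial.C (x₀ i) + Polynomial.C (v i) * Polynomial.X)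
        (Polynomial.aeval (R := ℝ) t) p
      have hf : (fun i => Polynomial.aeval (R := ℝ) t
          (Polynomial.C (x₀ i) + Polynomial.C (v i) * Polynomial.X)) =
          (x₀ + t • v : EuclideanSpace ℝ (Fin N)) := by
        ext i
        simp [mul_comm t]
      rw [hf] at h
      exact h
    have hline : ∀ t ∈ Set.Icc 0 ρ, x₀ + t • v ∈ closedBall x₀ ρ := fun t ht => by
      rw [mem_closedBall_iff_norm, add_sub_cancel_left, norm_smul, Real.norm_of_nonneg ht.1]
      exact (mul_le_of_le_one_right ht.1 hv).trans ht.2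
    have := hC₁ ρ hρ hρ1 g hgdeg (fun t => φ (x₀ + t • v))
      (hφ.comp (contDiff_const.add (contDiff_id.smul contDiff_const)))
      (fun j hj t ht => (norm_iteratedDeriv_comp_line_le hφ x₀ v hv (by exact_mod_cast hj) t).trans
        (hder j hj _ (hline t ht)))
      (fun t ht => by
        rw [hg, mul_assoc, ← mul_pow]
        refine (happ _ (hline t ht)).trans ?_
        gcongr
        rwa [div_le_iff₀' hβ0] at hρl)
    rw [hg, one_smul, ← hP] at this
    exact this.trans (le_abs_self _)
  have hz : x - x₀ ∈ closedBall (0 : EuclideanSpace ℝ (Fin N)) 1 := by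
    rw [mem_closedBall_zero_iff, ← mem_closedBall_iff_norm]
    exact closedBall_subset_closedBall hρ1 hx
  have hfin := hderiv j P hPdeg _ hbound _ hz
  simp only [hP] at hfin
  rw [iteratedFDeriv_comp_add_left (f := fun y : EuclideanSpace ℝ (Fin N) =>
    MvPolynomial.eval y p), add_sub_cancel] at hfin
  exact hfin.trans (Finset.single_le_sum (f := fun j => C₂ j * |C₁|)
    (fun i _ => mul_nonneg (hC₂ i) (abs_nonneg _)) (Finset.mem_range.mpr (by omega)))
end
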